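/- Under assumption A5 (integral arc balance with constant A > 1) and assuming solutions exist from every initial time and initial state, the continuous-time belief evolution achieves global agreement if and only if the persistent graph G^p is quasi-strongly connected. -/

import Mathlib

open Filter Finset MeasureTheory

/-- `ReachIn R k i j`: `j` can be reached from `i` in exactly `k` steps following relation `R`. -/
def ReachIn {α : Type*} (R : α → α → Prop) : ℕ → α → α → Prop
  | 0 => fun i j => i = j
  | k + 1 => fun i j => ∃ m, R i m ∧ ReachIn R k m j

/-- Distance from `i` to `j`: length of a shortest directed path. -/
noncomputable def distR {α : Type*} (R : α → α → Prop) (i j : α) : ℕ :=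
  sInf {k | ReachIn R k i j}

/-- Diameter: maximum of `distR i j` over pairs with `j` reachable from `i`. -/
noncomputable def diamR {α : Type*} (R : α → α → Prop) : ℕ :=
  sSup {d | ∃ i j, (∃ k, ReachIn R k i j) ∧ d = distR R i j}

/-- Regularity of the weight functions: nonnegative, measurable and locally integrable. -/
def CRegular (n : ℕ) (W : ℝ → Fin n → Fin n → ℝ) : Prop :=
  (∀ t i j, 0 ≤ W t i j) ∧ (∀ i j, Measurable fun t => W t i j) ∧
    (∀ i j, LocallyIntegrable (fun t => W t i j))

/-- A (Caratheodory) solution of the continuous-time belief evolution with initial time `t0`,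
written in integral form. -/
def CSol (n : ℕ) (W : ℝ → Fin n → Fin n → ℝ) (t0 : ℝ) (x : ℝ → Fin n → ℝ) : Prop :=
  (∀ i, ContinuousOn (fun t => x t i) (Set.Ici t0)) ∧
    ∀ i : Fin n, ∀ t : ℝ, t0 ≤ t →
      x t i = x t0 i + ∫ s in t0..t, ∑ j, W s i j * (x s j - x s i)

/-- Solutions exist from every initial time `t0 ≥ 0` and every initial state. -/
def CSolExists (n : ℕ) (W : ℝ → Fin n → Fin n → ℝ) : Prop :=
  ∀ t0 : ℝ, 0 ≤ t0 → ∀ x0 : Fin n → ℝ, ∃ x : ℝ → Fin n → ℝ,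
    CSol n W t0 x ∧ ∀ i, x t0 i = x0 i

/-- Maximum state Ψ(t). -/
noncomputable def cMax (n : ℕ) (x : ℝ → Fin n → ℝ) (t : ℝ) : ℝ := ⨆ i, x t i

/-- Minimum state ψ(t). -/
noncomputable def cMin (n : ℕ) (x : ℝ → Fin n → ℝ) (t : ℝ) : ℝ := ⨅ i, x t i

/-- Agreement measure H(t) = Ψ(t) − ψ(t). -/
noncomputable def cH (n : ℕ) (x : ℝ → Fin n → ℝ) (t : ℝ) : ℝ := cMax n x t - cMin n x t

/-- `(j,i)` is a persistent arc: `j ≠ i` and `∫_s^∞ W_ij(t) dt = ∞` for every `s ≥ 0`. -/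
def CPersistent (n : ℕ) (W : ℝ → Fin n → Fin n → ℝ) (j i : Fin n) : Prop :=
  j ≠ i ∧ ∀ s : ℝ, 0 ≤ s → Tendsto (fun T => ∫ t in s..T, W t i j) atTop atTop

/-- The persistent graph is quasi-strongly connected: it has a center. -/
def CQSC (n : ℕ) (W : ℝ → Fin n → Fin n → ℝ) : Prop :=
  ∃ c : Fin n, ∀ v : Fin n, ∃ k, ReachIn (CPersistent n W) k c v

/-- A3 (arc balance) with constant `A`. -/
def CArcBalance (n : ℕ) (W : ℝ → Fin n → Fin n → ℝ) (A : ℝ) : Prop :=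
  ∀ t : ℝ, 0 ≤ t → ∀ i j k m : Fin n, CPersistent n W j i → CPersistent n W m k →
    A⁻¹ * W t i j ≤ W t k m ∧ W t k m ≤ A * W t i j

/-- Global agreement for the continuous-time evolution. -/
def CAgree (n : ℕ) (W : ℝ → Fin n → Fin n → ℝ) : Prop :=
  ∀ t0 : ℝ, 0 ≤ t0 → ∀ x : ℝ → Fin n → ℝ, CSol n W t0 x →
    Tendsto (cH n x) atTop (nhds 0)

/-- Global ε-agreement for the continuous-time evolution. -/
def CEpsAgree (n : ℕ) (W : ℝ → Fin n → Fin n → ℝ) : Prop :=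
  ∃ ε : ℝ, 0 < ε ∧ ε < 1 ∧ ∃ T0 : ℝ, 0 < T0 ∧
    ∀ t0 : ℝ, 0 ≤ t0 → ∀ x : ℝ → Fin n → ℝ, CSol n W t0 x →
      ∀ t, t0 ≤ t → cH n x (t + T0) ≤ ε * cH n x t

/-- Condition (b): uniformly positive integrals over windows of length `τ0` for persistent arcs. -/
def CArcCond (n : ℕ) (W : ℝ → Fin n → Fin n → ℝ) : Prop :=
  ∃ a : ℝ, 0 < a ∧ ∃ τ : ℝ, 0 < τ ∧
    ∀ t : ℝ, 0 ≤ t → ∀ j i : Fin n, CPersistent n W j i →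
      a ≤ ∫ s in t..(t + τ), W s i j

open scoped Classical in
/-- θ(t): total weight at time `t` over non-persistent ordered pairs of distinct nodes. -/
noncomputable def cTheta (n : ℕ) (W : ℝ → Fin n → Fin n → ℝ) (t : ℝ) : ℝ :=
  ∑ i : Fin n, ∑ j : Fin n, if j ≠ i ∧ ¬ CPersistent n W j i then W t i j else 0

/-- ξ⁺(t;m) = ∑_{j ≠ m} W_mj(t). -/
def cXi (n : ℕ) (W : ℝ → Fin n → Fin n → ℝ) (t : ℝ) (m : Fin n) : ℝ :=
  ∑ j ∈ Finset.univ.erase m, W t m j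

/-- A5 (integral arc balance) with constant `A`. -/
def CIntegralArcBalance (n : ℕ) (W : ℝ → Fin n → Fin n → ℝ) (A : ℝ) : Prop :=
  ∀ a b : ℝ, 0 ≤ a → a < b → ∀ i j k m : Fin n,
    CPersistent n W j i → CPersistent n W m k →
      A⁻¹ * ∫ t in a..b, W t i j ≤ ∫ t in a..b, W t k m ∧
        (∫ t in a..b, W t k m) ≤ A * ∫ t in a..b, W t i j


lemma Wint {n : ℕ} {W : ℝ → Fin n → Fin n → ℝ} (hreg : CRegular n W) (i j : Fin n) (a b : ℝ) :
    IntervalIntegrable (fun t => W t i j) volume a b := by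
  rw [intervalIntegrable_iff']
  exact (hreg.2.2 i j).integrableOn_isCompact isCompact_uIcc

lemma int_sum {n : ℕ} {f : Fin n → ℝ → ℝ} (S : Finset (Fin n)) {a b : ℝ}
    (h : ∀ i ∈ S, IntervalIntegrable (f i) volume a b) :
    IntervalIntegrable (fun t => ∑ i ∈ S, f i t) volume a b := by
  have e : (fun t => ∑ i ∈ S, f i t) = ∑ i ∈ S, f i := by
    ext t
    simp
  rw [e]
  exact IntervalIntegrable.sum S h

lemma sol_int {n : ℕ} {W : ℝ → Fin n → Fin n → ℝ} (hreg : CRegular n W) {t0 : ℝ}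
    {x : ℝ → Fin n → ℝ} (hx : CSol n W t0 x) (i : Fin n) {s t : ℝ} (hs : t0 ≤ s) (hst : s ≤ t) :
    IntervalIntegrable (fun τ => ∑ j, W τ i j * (x τ j - x τ i)) volume s t := by
  apply int_sum
  intro j _
  apply (Wint hreg i j s t).mul_continuousOn
  rw [Set.uIcc_of_le hst]
  have hsub : Set.Icc s t ⊆ Set.Ici t0 := fun τ hτ => hs.trans hτ.1
  exact ((hx.1 j).mono hsub).sub ((hx.1 i).mono hsub)

lemma sol_eq {n : ℕ} {W : ℝ → Fin n → Fin n → ℝ} (hreg : CRegular n W) {t0 : ℝ}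
    {x : ℝ → Fin n → ℝ} (hx : CSol n W t0 x) (i : Fin n) {s t : ℝ} (hs : t0 ≤ s) (hst : s ≤ t) :
    x t i = x s i + ∫ τ in s..t, ∑ j, W τ i j * (x τ j - x τ i) := by
  rw [hx.2 i t (hs.trans hst), hx.2 i s hs,
    ← intervalIntegral.integral_add_adjacent_intervals (sol_int hreg hx i le_rfl hs)
      (sol_int hreg hx i hs hst)]
  ring

lemma sol_restart {n : ℕ} {W : ℝ → Fin n → Fin n → ℝ} (hreg : CRegular n W) {t0 : ℝ}
    {x : ℝ → Fin n → ℝ} (hx : CSol n W t0 x) {s : ℝ} (hs : t0 ≤ s) : CSol n W s x :=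
  ⟨fun i => (hx.1 i).mono (Set.Ici_subset_Ici.2 hs), fun i _ ht => sol_eq hreg hx i hs ht⟩

lemma sol_affine {n : ℕ} {W : ℝ → Fin n → Fin n → ℝ} {t0 : ℝ}
    {x : ℝ → Fin n → ℝ} (hx : CSol n W t0 x) (a b : ℝ) :
    CSol n W t0 (fun t i => a + b * x t i) := by
  refine ⟨fun i => continuousOn_const.add (continuousOn_const.mul (hx.1 i)), fun i t ht => ?_⟩
  have : ∀ s, ∑ j, W s i j * (a + b * x s j - (a + b * x s i))
      = b * ∑ j, W s i j * (x s j - x s i) := by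
    intro s
    rw [Finset.mul_sum]
    exact Finset.sum_congr rfl fun j _ => by ring
  simp only [this]
  rw [intervalIntegral.integral_const_mul, hx.2 i t ht]
  ring

/-- last time in `[s,t]` with `f ≥ a` -/
lemma last_time {f : ℝ → ℝ} {s t a : ℝ} (hst : s ≤ t) (hf : ContinuousOn f (Set.Icc s t))
    (hs : a ≤ f s) : ∃ u ∈ Set.Icc s t, a ≤ f u ∧ ∀ v ∈ Set.Ioc u t, f v < a := by
  have hcl : IsClosed (Set.Icc s t ∩ f ⁻¹' Set.Ici a) :=
    hf.preimage_isClosed_of_isClosed isClosed_Icc isClosed_Ici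
  have hcp : IsCompact (Set.Icc s t ∩ f ⁻¹' Set.Ici a) :=
    isCompact_Icc.of_isClosed_subset hcl Set.inter_subset_left
  obtain ⟨u, hu, hmax⟩ := hcp.exists_isGreatest ⟨s, ⟨le_rfl, hst⟩, hs⟩
  refine ⟨u, hu.1, hu.2, fun v hv => ?_⟩
  by_contra hcon
  exact absurd (hmax ⟨⟨hu.1.1.trans hv.1.le, hv.2⟩, not_lt.1 hcon⟩) (not_le.2 hv.1)

lemma pos_step {n : ℕ} {W : ℝ → Fin n → Fin n → ℝ} (hreg : CRegular n W) (S : Finset (Fin n))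
    (t0 : ℝ) (z g : ℝ → Fin n → ℝ)
    (hc : ∀ i ∈ S, ContinuousOn (fun t => z t i) (Set.Ici t0))
    (hg : ∀ i ∈ S, ∀ s t, t0 ≤ s → s ≤ t → IntervalIntegrable (fun τ => g τ i) volume s t ∧
      z t i = z s i + ∫ τ in s..t, g τ i)
    (hge : ∀ i ∈ S, ∀ τ, t0 ≤ τ → ∑ j ∈ S, W τ i j * (z τ j - z τ i) ≤ g τ i)
    (h0 : ∀ i ∈ S, 0 ≤ z t0 i) (t1 : ℝ) (h1 : t0 ≤ t1)
    (hw : ∀ i, ∫ τ in t0..t1, ∑ j ∈ S, W τ i j ≤ 1 / 2) : ∀ t ∈ Set.Icc t0 t1, ∀ i ∈ S, 0 ≤ z t i := by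
  by_contra! hcon
  obtain ⟨τ0, hτ0, i0, hi0, hneg⟩ := hcon
  have hmin : ∀ i ∈ S, ∃ τ ∈ Set.Icc t0 t1, ∀ v ∈ Set.Icc t0 t1, z τ i ≤ z v i := by
    intro i hi
    exact isCompact_Icc.exists_isMinOn ⟨t0, le_rfl, h1⟩ ((hc i hi).mono fun v hv => hv.1)
  choose! m hm hmm using hmin
  obtain ⟨i, hi, hii⟩ := S.exists_min_image (fun i => z (m i) i) ⟨i0, hi0⟩
  set μ := z (m i) i with hμ
  have hall : ∀ j ∈ S, ∀ v ∈ Set.Icc t0 t1, μ ≤ z v j := fun j hj v hv =>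
    (hii j hj).trans (hmm j hj v hv)
  have hμ0 : μ < 0 := (hall i0 hi0 τ0 hτ0).trans_lt hneg
  have hmi := hm i hi
  obtain ⟨u, hu, hu0, hlast⟩ := last_time (f := fun t => z t i) hmi.1
    ((hc i hi).mono fun v hv => hv.1) (h0 i hi)
  obtain ⟨hint, heq⟩ := hg i hi u (m i) hu.1 hu.2
  have hwi : ∀ a b, IntervalIntegrable (fun τ => ∑ j ∈ S, W τ i j) volume a b :=
    fun a b => int_sum S fun j _ => Wint hreg i j a b
  have hle : ∫ τ in u..(m i), μ * ∑ j ∈ S, W τ i j ≤ ∫ τ in u..(m i), g τ i := by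
    apply intervalIntegral.integral_mono_on_of_le_Ioo hu.2 ((hwi _ _).const_mul μ) hint
    intro v hv
    have hv0 : t0 ≤ v := hu.1.trans hv.1.le
    refine le_trans ?_ (hge i hi v hv0)
    rw [Finset.mul_sum]
    apply Finset.sum_le_sum
    intro j hj
    have a1 := hall j hj v ⟨hv0, hv.2.le.trans hmi.2⟩
    have a2 := hlast v ⟨hv.1, hv.2.le⟩
    have a3 := hreg.1 v i j
    nlinarith
  rw [intervalIntegral.integral_const_mul] at hle
  have hmono : ∫ τ in u..(m i), ∑ j ∈ S, W τ i j ≤ ∫ τ in t0..t1, ∑ j ∈ S, W τ i j := by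
    apply intervalIntegral.integral_mono_interval hu.1 hu.2 hmi.2 _ (hwi _ _)
    exact Eventually.of_forall fun v => Finset.sum_nonneg fun j _ => hreg.1 v i j
  have := hw i
  nlinarith

lemma pos_inv {n : ℕ} {W : ℝ → Fin n → Fin n → ℝ} (hreg : CRegular n W) (S : Finset (Fin n))
    (t0 : ℝ) (z g : ℝ → Fin n → ℝ)
    (hc : ∀ i ∈ S, ContinuousOn (fun t => z t i) (Set.Ici t0))
    (hg : ∀ i ∈ S, ∀ s t, t0 ≤ s → s ≤ t → IntervalIntegrable (fun τ => g τ i) volume s t ∧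
      z t i = z s i + ∫ τ in s..t, g τ i)
    (hge : ∀ i ∈ S, ∀ τ, t0 ≤ τ → ∑ j ∈ S, W τ i j * (z τ j - z τ i) ≤ g τ i)
    (h0 : ∀ i ∈ S, 0 ≤ z t0 i) : ∀ t, t0 ≤ t → ∀ i ∈ S, 0 ≤ z t i := by
  intro T hT
  have key : Set.Icc t0 T ⊆ {t | ∀ i ∈ S, 0 ≤ z t i} := by
    apply IsClosed.Icc_subset_of_forall_exists_gt
    · have : {t | ∀ i ∈ S, 0 ≤ z t i} ∩ Set.Icc t0 T =
          Set.Icc t0 T ∩ ⋂ i ∈ S, (Set.Icc t0 T ∩ (fun t => z t i) ⁻¹' Set.Ici 0) := by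
        ext t
        simp only [Set.mem_inter_iff, Set.mem_ofPred_eq, Set.mem_iInter, Set.mem_preimage,
          Set.mem_Ici]
        constructor
        · rintro ⟨h1, h2⟩
          exact ⟨h2, fun i hi => ⟨h2, h1 i hi⟩⟩
        · rintro ⟨h1, h2⟩
          exact ⟨fun i hi => (h2 i hi).2, h1⟩
      rw [this]
      apply isClosed_Icc.inter
      apply isClosed_biInter
      intro i hi
      exact ((hc i hi).mono fun v hv => hv.1).preimage_isClosed_of_isClosed isClosed_Icc isClosed_Ici
    · exact h0
    · rintro s ⟨hs0, hs⟩ y hy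
      have hev : ∀ᶠ t in nhdsWithin s (Set.Ioi s), ∀ i, ∫ τ in s..t, ∑ j ∈ S, W τ i j ≤ 1 / 2 := by
        rw [eventually_all]
        intro i
        have hcont := intervalIntegral.continuous_primitive (μ := volume)
          (f := fun τ => ∑ j ∈ S, W τ i j)
          (fun a b => int_sum S fun j _ => Wint hreg i j a b) s
        have h2 := hcont.tendsto s
        simp only [intervalIntegral.integral_same] at h2
        have h3 := h2.eventually (eventually_le_nhds (show (0 : ℝ) < 1 / 2 by norm_num))
        exact h3.filter_mono nhdsWithin_le_nhds
      have hev2 : ∀ᶠ t in nhdsWithin s (Set.Ioi s), t ∈ Set.Ioc s y :=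
        Ioc_mem_nhdsGT hy
      obtain ⟨t, ht1, ht2⟩ := (hev.and hev2).exists
      refine ⟨t, ?_, ht2⟩
      exact pos_step hreg S s z g (fun i hi => (hc i hi).mono (Set.Ici_subset_Ici.2 hs.1))
        (fun i hi a b ha hab => hg i hi a b (hs.1.trans ha) hab)
        (fun i hi τ hτ => hge i hi τ (hs.1.trans hτ)) hs0 t ht2.1.le ht1 t ⟨ht2.1.le, le_rfl⟩
  exact key ⟨hT, le_rfl⟩

lemma sol_nonneg {n : ℕ} {W : ℝ → Fin n → Fin n → ℝ} (hreg : CRegular n W) {t0 : ℝ}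
    {x : ℝ → Fin n → ℝ} (hx : CSol n W t0 x) (h0 : ∀ i, 0 ≤ x t0 i) :
    ∀ t, t0 ≤ t → ∀ i, 0 ≤ x t i := by
  intro t ht i
  exact pos_inv hreg Finset.univ t0 x (fun τ i => ∑ j, W τ i j * (x τ j - x τ i))
    (fun i _ => hx.1 i) (fun i _ s t hs hst => ⟨sol_int hreg hx i hs hst, sol_eq hreg hx i hs hst⟩)
    (fun i _ τ _ => le_rfl) (fun i _ => h0 i) t ht i (Finset.mem_univ i)

lemma xi_int {n : ℕ} {W : ℝ → Fin n → Fin n → ℝ} (hreg : CRegular n W) (i : Fin n) (a b : ℝ) :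
    IntervalIntegrable (fun t => cXi n W t i) volume a b :=
  int_sum _ fun j _ => Wint hreg i j a b

lemma xi_nonneg {n : ℕ} {W : ℝ → Fin n → Fin n → ℝ} (hreg : CRegular n W) (i : Fin n) (t : ℝ) :
    0 ≤ cXi n W t i := Finset.sum_nonneg fun j _ => hreg.1 t i j

lemma drift_eq {n : ℕ} (W : ℝ → Fin n → Fin n → ℝ) (y : ℝ → Fin n → ℝ) (i : Fin n) (t : ℝ) :
    ∑ j, W t i j * (y t j - y t i) = ∑ j ∈ Finset.univ.erase i, W t i j * y t j
      - cXi n W t i * y t i := by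
  rw [← Finset.add_sum_erase _ _ (Finset.mem_univ i), cXi, Finset.sum_mul,
    ← Finset.sum_sub_distrib]
  simp only [sub_self, mul_zero, zero_add]
  exact Finset.sum_congr rfl fun j _ => by ring

lemma decay {n : ℕ} {W : ℝ → Fin n → Fin n → ℝ} (hreg : CRegular n W) {t0 : ℝ}
    {y : ℝ → Fin n → ℝ} (hy : CSol n W t0 y) (h0 : ∀ t, t0 ≤ t → ∀ i, 0 ≤ y t i)
    (i : Fin n) {s t : ℝ} (hs : t0 ≤ s) (hst : s ≤ t)
    (hK : ∫ τ in s..t, cXi n W τ i ≤ 1 / 2) {a : ℝ} (ha : 0 ≤ a) (has : a ≤ y s i) :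
    a / 2 ≤ y t i := by
  obtain ⟨u, hu, hua, hlast⟩ := last_time (f := fun t => y t i) hst
    ((hy.1 i).mono fun v hv => hs.trans hv.1) has
  have hle : ∫ τ in u..t, (-a) * cXi n W τ i ≤
      ∫ τ in u..t, ∑ j, W τ i j * (y τ j - y τ i) := by
    apply intervalIntegral.integral_mono_on_of_le_Ioo hu.2 ((xi_int hreg i _ _).const_mul _)
      (sol_int hreg hy i (hs.trans hu.1) hu.2)
    intro v hv
    rw [drift_eq]
    have a1 : 0 ≤ ∑ j ∈ Finset.univ.erase i, W v i j * y v j :=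
      Finset.sum_nonneg fun j _ => mul_nonneg (hreg.1 v i j) (h0 v (hs.trans (hu.1.trans hv.1.le)) j)
    have a2 := hlast v ⟨hv.1, hv.2.le⟩
    have a3 := xi_nonneg hreg i v
    nlinarith
  rw [intervalIntegral.integral_const_mul] at hle
  have hmono : ∫ τ in u..t, cXi n W τ i ≤ ∫ τ in s..t, cXi n W τ i :=
    intervalIntegral.integral_mono_interval hu.1 hu.2 le_rfl
      (Eventually.of_forall fun v => xi_nonneg hreg i v) (xi_int hreg i _ _)
  have heq := sol_eq hreg hy i (hs.trans hu.1) hu.2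
  nlinarith

lemma input {n : ℕ} {W : ℝ → Fin n → Fin n → ℝ} (hreg : CRegular n W) {t0 : ℝ}
    {y : ℝ → Fin n → ℝ} (hy : CSol n W t0 y) (h0 : ∀ t, t0 ≤ t → ∀ i, 0 ≤ y t i)
    (i j : Fin n) (hji : j ≠ i) {s t : ℝ} (hs : t0 ≤ s) (hst : s ≤ t)
    (hK : ∫ τ in s..t, cXi n W τ i ≤ 1 / 2) {p δ : ℝ} (hp : 0 ≤ p) (hδ : 0 ≤ δ)
    (hW : p ≤ ∫ τ in s..t, W τ i j) (hyj : ∀ τ ∈ Set.Icc s t, δ ≤ y τ j) :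
    δ * p / 4 ≤ y t i := by
  have hc : 0 ≤ δ * p / 2 := by positivity
  by_cases hu : ∃ u ∈ Set.Icc s t, δ * p / 2 ≤ y u i
  · obtain ⟨u, hu, hua⟩ := hu
    have hmono : ∫ τ in u..t, cXi n W τ i ≤ ∫ τ in s..t, cXi n W τ i :=
      intervalIntegral.integral_mono_interval hu.1 hu.2 le_rfl
        (Eventually.of_forall fun v => xi_nonneg hreg i v) (xi_int hreg i _ _)
    have := decay hreg hy h0 i (hs.trans hu.1) hu.2 (hmono.trans hK) hc hua
    linarith
  · push Not at hu
    have hle : ∫ τ in s..t, (δ * W τ i j - (δ * p / 2) * cXi n W τ i) ≤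
        ∫ τ in s..t, ∑ j, W τ i j * (y τ j - y τ i) := by
      apply intervalIntegral.integral_mono_on hst
        (((Wint hreg i j _ _).const_mul _).sub ((xi_int hreg i _ _).const_mul _))
        (sol_int hreg hy i hs hst)
      intro v hv
      rw [drift_eq]
      have a1 : W v i j * y v j ≤ ∑ j ∈ Finset.univ.erase i, W v i j * y v j :=
        Finset.single_le_sum (f := fun j => W v i j * y v j)
          (fun j _ => mul_nonneg (hreg.1 v i j) (h0 v (hs.trans hv.1) j))
          (Finset.mem_erase.2 ⟨hji, Finset.mem_univ j⟩)
      have a2 := hu v hv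
      have a3 := xi_nonneg hreg i v
      have a4 := hyj v hv
      have a5 := hreg.1 v i j
      nlinarith
    rw [intervalIntegral.integral_sub ((Wint hreg i j _ _).const_mul _)
      ((xi_int hreg i _ _).const_mul _), intervalIntegral.integral_const_mul,
      intervalIntegral.integral_const_mul] at hle
    have heq := sol_eq hreg hy i hs hst
    have := h0 s hs i
    nlinarith [mul_le_mul_of_nonneg_left hW hδ]

/-- A window: total incoming weight at most 1/2, each persistent arc at least `p`. -/
def Win (n : ℕ) (W : ℝ → Fin n → Fin n → ℝ) (p s t : ℝ) : Prop :=
  s ≤ t ∧ (∀ i, ∫ τ in s..t, cXi n W τ i ≤ 1 / 2) ∧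
    ∀ i j, CPersistent n W j i → p ≤ ∫ τ in s..t, W τ i j

lemma win_step {n : ℕ} {W : ℝ → Fin n → Fin n → ℝ} (hreg : CRegular n W) {t0 : ℝ}
    {y : ℝ → Fin n → ℝ} (hy : CSol n W t0 y) (h0 : ∀ t, t0 ≤ t → ∀ i, 0 ≤ y t i)
    {p s t : ℝ} (hp : 0 ≤ p) (hs : t0 ≤ s) (hw : Win n W p s t) (i j : Fin n)
    (hji : CPersistent n W j i) {δ : ℝ} (hδ : 0 ≤ δ) (hyj : δ ≤ y s j) :
    δ * (p / 8) ≤ y t i := by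
  have := input hreg hy h0 i j hji.1 hs hw.1 (hw.2.1 i) (δ := δ / 2) hp (by linarith)
    (hw.2.2 i j hji) (fun τ hτ => by
      have hmono : ∫ v in s..τ, cXi n W v j ≤ ∫ v in s..t, cXi n W v j :=
        intervalIntegral.integral_mono_interval le_rfl hτ.1 hτ.2
          (Eventually.of_forall fun v => xi_nonneg hreg j v) (xi_int hreg j _ _)
      exact decay hreg hy h0 j hs hτ.1 (hmono.trans (hw.2.1 j)) hδ hyj)
  linarith

lemma win_reach {n : ℕ} {W : ℝ → Fin n → Fin n → ℝ} (hreg : CRegular n W) {t0 : ℝ}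
    {y : ℝ → Fin n → ℝ} (hy : CSol n W t0 y) (h0 : ∀ t, t0 ≤ t → ∀ i, 0 ≤ y t i)
    {p : ℝ} (hp : 0 ≤ p) (σ : ℕ → ℝ) (hσ : ∀ k, Win n W p (σ k) (σ (k + 1)))
    (k : ℕ) : ∀ (l : ℕ) (_ : t0 ≤ σ l) (i j : Fin n) (_ : ReachIn (CPersistent n W) k i j)
    (δ : ℝ) (_ : 0 ≤ δ) (_ : δ ≤ y (σ l) i), δ * (p / 8) ^ k ≤ y (σ (l + k)) j := by
  induction k with
  | zero =>
    intro l _ i j h δ _ h2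
    have : i = j := h
    subst this
    simpa using h2
  | succ k ih =>
    intro l hl i j h δ hδ h2
    obtain ⟨m, him, hmj⟩ := h
    have h3 := win_step hreg hy h0 hp hl (hσ l) m i him hδ h2
    have h4 := ih (l + 1) (hl.trans (hσ l).1) m j hmj _ (by positivity) h3
    rw [show l + (k + 1) = l + 1 + k by ring, pow_succ']
    linarith

lemma win_stay {n : ℕ} {W : ℝ → Fin n → Fin n → ℝ} (hreg : CRegular n W) {t0 : ℝ}
    {y : ℝ → Fin n → ℝ} (hy : CSol n W t0 y) (h0 : ∀ t, t0 ≤ t → ∀ i, 0 ≤ y t i)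
    {p : ℝ} (hp : 0 ≤ p) (hp1 : p ≤ 1) (σ : ℕ → ℝ) (hσ : ∀ k, Win n W p (σ k) (σ (k + 1)))
    (k : ℕ) : ∀ (l : ℕ) (_ : t0 ≤ σ l) (i : Fin n)
    (δ : ℝ) (_ : 0 ≤ δ) (_ : δ ≤ y (σ l) i), δ * (p / 8) ^ k ≤ y (σ (l + k)) i := by
  induction k with
  | zero =>
    intro l _ i δ _ h2
    simpa using h2
  | succ k ih =>
    intro l hl i δ hδ h2
    have h3 := decay hreg hy h0 i hl (hσ l).1 ((hσ l).2.1 i) hδ h2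
    have h5 : δ * (p / 8) ≤ y (σ (l + 1)) i := by nlinarith
    have h4 := ih (l + 1) (hl.trans (hσ l).1) i _ (by positivity) h5
    rw [show l + (k + 1) = l + 1 + k by ring, pow_succ']
    linarith

lemma win_all {n : ℕ} {W : ℝ → Fin n → Fin n → ℝ} (hreg : CRegular n W) (c : Fin n) (N : ℕ)
    (hN : ∀ v, ∃ k ≤ N, ReachIn (CPersistent n W) k c v)
    {p : ℝ} (hp : 0 ≤ p) (hp1 : p ≤ 1) (σ : ℕ → ℝ) (hσ : ∀ k, Win n W p (σ k) (σ (k + 1)))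
    {l : ℕ} {y : ℝ → Fin n → ℝ} (hy : CSol n W (σ l) y) (h0 : ∀ i, 0 ≤ y (σ l) i)
    {δ : ℝ} (hδ : 0 ≤ δ) (hc : δ ≤ y (σ l) c) (v : Fin n) :
    δ * (p / 8) ^ N ≤ y (σ (l + N)) v := by
  have h0' := sol_nonneg hreg hy h0
  have hmono : Monotone σ := monotone_nat_of_le_succ fun k => (hσ k).1
  obtain ⟨k, hk, hr⟩ := hN v
  have h1 := win_reach hreg hy h0' hp σ hσ k l le_rfl c v hr δ hδ hc
  have h2 := win_stay hreg hy h0' hp hp1 σ hσ (N - k) (l + k) (hmono (by omega)) v _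
    (by positivity) h1
  rw [mul_assoc, ← pow_add, show k + (N - k) = N by omega,
    show l + k + (N - k) = l + N by omega] at h2
  exact h2

lemma le_cMax {n : ℕ} (x : ℝ → Fin n → ℝ) (t : ℝ) (i : Fin n) : x t i ≤ cMax n x t :=
  le_ciSup (Set.finite_range (x t)).bddAbove i

lemma cMin_le {n : ℕ} (x : ℝ → Fin n → ℝ) (t : ℝ) (i : Fin n) : cMin n x t ≤ x t i :=
  ciInf_le (Set.finite_range (x t)).bddBelow i

lemma cH_le {n : ℕ} (hn : 2 ≤ n) (x : ℝ → Fin n → ℝ) (t a b : ℝ) (h : ∀ i, a ≤ x t i)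
    (h' : ∀ i, x t i ≤ b) : cH n x t ≤ b - a := by
  have : Nonempty (Fin n) := ⟨⟨0, by omega⟩⟩
  have h1 : cMax n x t ≤ b := ciSup_le h'
  have h2 : a ≤ cMin n x t := le_ciInf h
  unfold cH
  linarith

lemma cH_nonneg {n : ℕ} (hn : 2 ≤ n) (x : ℝ → Fin n → ℝ) (t : ℝ) : 0 ≤ cH n x t := by
  have h1 := le_cMax x t ⟨0, by omega⟩
  have h2 := cMin_le x t ⟨0, by omega⟩
  unfold cH
  linarith

lemma sol_le_max {n : ℕ} {W : ℝ → Fin n → Fin n → ℝ} (hreg : CRegular n W) {t0 : ℝ}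
    {x : ℝ → Fin n → ℝ} (hx : CSol n W t0 x) {b : ℝ} (hb : ∀ i, x t0 i ≤ b) {t : ℝ} (ht : t0 ≤ t)
    (i : Fin n) : x t i ≤ b := by
  have := sol_nonneg hreg (sol_affine hx b (-1)) (fun i => by linarith [hb i]) t ht i
  linarith

lemma sol_ge_min {n : ℕ} {W : ℝ → Fin n → Fin n → ℝ} (hreg : CRegular n W) {t0 : ℝ}
    {x : ℝ → Fin n → ℝ} (hx : CSol n W t0 x) {b : ℝ} (hb : ∀ i, b ≤ x t0 i) {t : ℝ} (ht : t0 ≤ t)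
    (i : Fin n) : b ≤ x t i := by
  have := sol_nonneg hreg (sol_affine hx (-b) 1) (fun i => by linarith [hb i]) t ht i
  linarith

lemma cH_anti {n : ℕ} (hn : 2 ≤ n) {W : ℝ → Fin n → Fin n → ℝ} (hreg : CRegular n W) {t0 : ℝ}
    {x : ℝ → Fin n → ℝ} (hx : CSol n W t0 x) {s t : ℝ} (hs : t0 ≤ s) (hst : s ≤ t) :
    cH n x t ≤ cH n x s := by
  have hx' := sol_restart hreg hx hs
  exact cH_le hn x t _ _ (fun i => sol_ge_min hreg hx' (cMin_le x s) hst i)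
    (fun i => sol_le_max hreg hx' (le_cMax x s) hst i)

lemma contract {n : ℕ} (hn : 2 ≤ n) {W : ℝ → Fin n → Fin n → ℝ} (hreg : CRegular n W)
    (c : Fin n) (N : ℕ)
    (hN : ∀ v, ∃ k ≤ N, ReachIn (CPersistent n W) k c v)
    {p : ℝ} (hp : 0 ≤ p) (hp1 : p ≤ 1) (σ : ℕ → ℝ) (hσ : ∀ k, Win n W p (σ k) (σ (k + 1)))
    {l : ℕ} {x : ℝ → Fin n → ℝ} (hx : CSol n W (σ l) x) :
    cH n x (σ (l + N)) ≤ (1 - (p / 8) ^ N / 2) * cH n x (σ l) := by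
  have hmono : Monotone σ := monotone_nat_of_le_succ fun k => (hσ k).1
  have hH := cH_nonneg hn x (σ l)
  have hle : σ l ≤ σ (l + N) := hmono (by omega)
  have hHd : cH n x (σ l) = cMax n x (σ l) - cMin n x (σ l) := rfl
  rcases le_total (x (σ l) c) ((cMax n x (σ l) + cMin n x (σ l)) / 2) with h | h
  · have := cH_le hn x (σ (l + N)) (cMin n x (σ l))
      (cMax n x (σ l) - cH n x (σ l) / 2 * (p / 8) ^ N)
      (fun i => sol_ge_min hreg hx (cMin_le x _) hle i) (fun i => by
        have := win_all hreg c N hN hp hp1 σ hσ (sol_affine hx (cMax n x (σ l)) (-1))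
          (fun i => by linarith [le_cMax x (σ l) i]) (δ := cH n x (σ l) / 2) (by linarith)
          (by linarith) i
        linarith)
    linarith
  · have := cH_le hn x (σ (l + N)) (cMin n x (σ l) + cH n x (σ l) / 2 * (p / 8) ^ N)
      (cMax n x (σ l)) (fun i => by
        have := win_all hreg c N hN hp hp1 σ hσ (sol_affine hx (-cMin n x (σ l)) 1)
          (fun i => by linarith [cMin_le x (σ l) i]) (δ := cH n x (σ l) / 2) (by linarith)
          (by linarith) i
        linarith)
      (fun i => sol_le_max hreg hx (le_cMax x _) hle i)
    linarith

lemma agree_of_wins {n : ℕ} (hn : 2 ≤ n) {W : ℝ → Fin n → Fin n → ℝ} (hreg : CRegular n W)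
    (c : Fin n) (N : ℕ)
    (hN : ∀ v, ∃ k ≤ N, ReachIn (CPersistent n W) k c v)
    {p : ℝ} (hp : 0 < p) (hp1 : p ≤ 1) (σ : ℕ → ℝ) (hσ : ∀ k, Win n W p (σ k) (σ (k + 1)))
    {t0 : ℝ} (h0 : t0 ≤ σ 0) {x : ℝ → Fin n → ℝ} (hx : CSol n W t0 x) :
    Tendsto (cH n x) atTop (nhds 0) := by
  have hmono : Monotone σ := monotone_nat_of_le_succ fun k => (hσ k).1
  set r : ℝ := 1 - (p / 8) ^ N / 2 with hr
  have hq1 : (p / 8) ^ N ≤ 1 := pow_le_one₀ (by positivity) (by linarith)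
  have hq0 : 0 < (p / 8) ^ N := by positivity
  have hk : ∀ k : ℕ, cH n x (σ (k * N)) ≤ r ^ k * cH n x (σ 0) := by
    intro k
    induction k with
    | zero => simp
    | succ k ih =>
      have := contract hn hreg c N hN hp.le hp1 σ hσ (l := k * N)
        (sol_restart hreg hx (h0.trans (hmono (Nat.zero_le _))))
      rw [show (k + 1) * N = k * N + N by ring, pow_succ']
      calc _ ≤ _ := this
        _ ≤ r * (r ^ k * cH n x (σ 0)) := by
          apply mul_le_mul_of_nonneg_left ih
          linarith
        _ = _ := by ring
  have hlim : Tendsto (fun k : ℕ => r ^ k * cH n x (σ 0)) atTop (nhds 0) := by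
    have := (tendsto_pow_atTop_nhds_zero_of_lt_one (r := r) (by rw [hr]; linarith)
      (by rw [hr]; linarith)).mul_const (cH n x (σ 0))
    simpa using this
  rw [Metric.tendsto_atTop]
  intro ε hε
  obtain ⟨k, hk'⟩ := (hlim.eventually (gt_mem_nhds hε)).exists
  refine ⟨σ (k * N), fun t ht => ?_⟩
  rw [Real.dist_eq, sub_zero, abs_of_nonneg (cH_nonneg hn x t)]
  exact ((cH_anti hn hreg hx (h0.trans (hmono (Nat.zero_le _))) ht).trans (hk k)).trans_lt hk'

open scoped Classical in
/-- non-persistent weight -/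
noncomputable def hW (n : ℕ) (W : ℝ → Fin n → Fin n → ℝ) (i j : Fin n) (t : ℝ) : ℝ :=
  if j ≠ i ∧ ¬ CPersistent n W j i then W t i j else 0

lemma theta_eq (n : ℕ) (W : ℝ → Fin n → Fin n → ℝ) (t : ℝ) :
    cTheta n W t = ∑ i, ∑ j, hW n W i j t := rfl

lemma hW_nonneg {n : ℕ} {W : ℝ → Fin n → Fin n → ℝ} (hreg : CRegular n W) (i j : Fin n) (t : ℝ) :
    0 ≤ hW n W i j t := by
  unfold hW
  split_ifs
  · exact hreg.1 t i j
  · exact le_rfl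

lemma hW_int {n : ℕ} {W : ℝ → Fin n → Fin n → ℝ} (hreg : CRegular n W) (i j : Fin n) (a b : ℝ) :
    IntervalIntegrable (hW n W i j) volume a b := by
  unfold hW
  split_ifs
  · exact Wint hreg i j a b
  · exact intervalIntegrable_const

lemma theta_int {n : ℕ} {W : ℝ → Fin n → Fin n → ℝ} (hreg : CRegular n W) (a b : ℝ) :
    IntervalIntegrable (cTheta n W) volume a b :=
  int_sum _ fun i _ => int_sum _ fun j _ => hW_int hreg i j a b

lemma theta_integral {n : ℕ} {W : ℝ → Fin n → Fin n → ℝ} (hreg : CRegular n W) (a b : ℝ) :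
    ∫ t in a..b, cTheta n W t = ∑ i, ∑ j, ∫ t in a..b, hW n W i j t := by
  simp only [theta_eq]
  rw [intervalIntegral.integral_finsetSum fun i _ => int_sum _ fun j _ => hW_int hreg i j a b]
  refine Finset.sum_congr rfl fun i _ => ?_
  rw [intervalIntegral.integral_finsetSum fun j _ => hW_int hreg i j a b]

lemma W_tail {n : ℕ} {W : ℝ → Fin n → Fin n → ℝ} (hreg : CRegular n W) (i j : Fin n)
    (hji : j ≠ i) (hnp : ¬ CPersistent n W j i) {ε : ℝ} (hε : 0 < ε) :
    ∀ᶠ T in atTop, ∀ s t : ℝ, T ≤ s → s ≤ t → ∫ τ in s..t, W τ i j ≤ ε := by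
  have hadd : ∀ a b c : ℝ, ∫ τ in a..c, W τ i j
      = (∫ τ in a..b, W τ i j) + ∫ τ in b..c, W τ i j := fun a b c =>
    (intervalIntegral.integral_add_adjacent_intervals (Wint hreg i j a b) (Wint hreg i j b c)).symm
  have hmono : Monotone fun T => ∫ τ in (0 : ℝ)..T, W τ i j := by
    intro a b hab
    simp only
    rw [hadd 0 a b]
    have := intervalIntegral.integral_nonneg (μ := volume) hab fun u _ => hreg.1 u i j
    linarith
  rcases tendsto_atTop_of_monotone hmono with h | ⟨l, h⟩
  · exfalso
    apply hnp
    refine ⟨hji, fun s _ => ?_⟩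
    have h2 := tendsto_atTop_add_const_left atTop (∫ τ in s..0, W τ i j) h
    refine h2.congr fun T => ?_
    rw [hadd s 0 T]
  · filter_upwards [h.eventually (lt_mem_nhds (show l - ε < l by linarith))] with T hT s t hs hst
    have h1 := hmono.ge_of_tendsto h t
    have h2 := hmono hs
    have h3 := hadd 0 s t
    simp only at h1 h2
    linarith

lemma theta_tail {n : ℕ} (hn : 2 ≤ n) {W : ℝ → Fin n → Fin n → ℝ} (hreg : CRegular n W) (T1 : ℝ) :
    ∃ T0 : ℝ, T1 ≤ T0 ∧ ∀ s t, T0 ≤ s → s ≤ t → ∫ τ in s..t, cTheta n W τ ≤ 1 / 4 := by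
  have hn0 : (0 : ℝ) < n := by exact_mod_cast (by omega : 0 < n)
  have hev : ∀ᶠ T in atTop, ∀ i j, ∀ s t : ℝ, T ≤ s → s ≤ t →
      ∫ τ in s..t, hW n W i j τ ≤ 1 / (4 * n * n) := by
    rw [eventually_all]
    intro i
    rw [eventually_all]
    intro j
    unfold hW
    split_ifs with hh
    · exact W_tail hreg i j hh.1 hh.2 (by positivity)
    · refine Eventually.of_forall fun T s t _ _ => ?_
      simp only [intervalIntegral.integral_zero]
      positivity
  obtain ⟨T, hT, hT1⟩ := (hev.and (eventually_ge_atTop T1)).exists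
  refine ⟨T, hT1, fun s t hs hst => ?_⟩
  rw [theta_integral hreg]
  calc ∑ i, ∑ j, ∫ τ in s..t, hW n W i j τ ≤ ∑ _i : Fin n, ∑ _j : Fin n, (1 / (4 * n * n) : ℝ) :=
        Finset.sum_le_sum fun i _ => Finset.sum_le_sum fun j _ => hT i j s t hs hst
    _ = 1 / 4 := by
      simp only [Finset.sum_const, Finset.card_univ, Fintype.card_fin, nsmul_eq_mul]
      field_simp

lemma exists_win {n : ℕ} (hn : 2 ≤ n) {W : ℝ → Fin n → Fin n → ℝ} (hreg : CRegular n W)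
    {A : ℝ} (hA : 1 < A) (hA5 : CIntegralArcBalance n W A) (i0 j0 : Fin n)
    (href : CPersistent n W j0 i0) {T0 : ℝ} (hT0 : 0 ≤ T0)
    (htail : ∀ s t, T0 ≤ s → s ≤ t → ∫ τ in s..t, cTheta n W τ ≤ 1 / 4)
    (s : ℝ) (hs : T0 ≤ s) : ∃ t, Win n W (A⁻¹ * (1 / (4 * n * A))) s t := by
  have hn0 : (0 : ℝ) < n := by exact_mod_cast (by omega : 0 < n)
  have hη : 0 < 1 / (4 * n * A) := by positivity
  obtain ⟨T1, h1, h2⟩ := (((href.2 s (hT0.trans hs)).eventually_ge_atTop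
    (1 / (4 * n * A))).and (eventually_ge_atTop s)).exists
  have hcont := intervalIntegral.continuous_primitive (μ := volume)
    (f := fun τ => W τ i0 j0) (fun a b => Wint hreg i0 j0 a b) s
  obtain ⟨t, ht, hte⟩ := intermediate_value_Icc h2 hcont.continuousOn
    (show 1 / (4 * n * A) ∈ _ from ⟨by simpa using hη.le, h1⟩)
  simp only at hte
  have hst : s < t := by
    rcases ht.1.lt_or_eq with h | h
    · exact h
    · rw [← h, intervalIntegral.integral_same] at hte
      linarith
  have hpers : ∀ i j, CPersistent n W j i → A⁻¹ * (1 / (4 * n * A)) ≤ ∫ τ in s..t, W τ i j ∧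
      ∫ τ in s..t, W τ i j ≤ A * (1 / (4 * n * A)) := by
    intro i j hij
    rw [← hte]
    exact hA5 s t (hT0.trans hs) hst i0 j0 i j href hij
  refine ⟨t, hst.le, fun i => ?_, fun i j hij => (hpers i j hij).1⟩
  have hh0 : ∀ i j, 0 ≤ ∫ τ in s..t, hW n W i j τ := fun i j =>
    intervalIntegral.integral_nonneg hst.le fun u _ => hW_nonneg hreg i j u
  unfold cXi
  rw [intervalIntegral.integral_finsetSum fun j _ => Wint hreg i j s t]
  have hAη : 0 ≤ A * (1 / (4 * n * A)) := by positivity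
  calc ∑ j ∈ Finset.univ.erase i, ∫ τ in s..t, W τ i j
      ≤ ∑ j ∈ Finset.univ.erase i, (A * (1 / (4 * n * A)) + ∫ τ in s..t, hW n W i j τ) := by
        apply Finset.sum_le_sum
        intro j hj
        by_cases hp : CPersistent n W j i
        · linarith [(hpers i j hp).2, hh0 i j]
        · have : hW n W i j = fun τ => W τ i j := by
            ext τ
            unfold hW
            rw [if_pos ⟨(Finset.mem_erase.1 hj).1, hp⟩]
          rw [this]
          linarith
    _ ≤ ∑ j, (A * (1 / (4 * n * A)) + ∫ τ in s..t, hW n W i j τ) :=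
        Finset.sum_le_sum_of_subset_of_nonneg (Finset.erase_subset _ _)
          fun j _ _ => add_nonneg hAη (hh0 i j)
    _ = 1 / 4 + ∑ j, ∫ τ in s..t, hW n W i j τ := by
        rw [Finset.sum_add_distrib]
        simp only [Finset.sum_const, Finset.card_univ, Fintype.card_fin, nsmul_eq_mul]
        congr 1
        field_simp
    _ ≤ 1 / 4 + ∑ i, ∑ j, ∫ τ in s..t, hW n W i j τ := by
        apply add_le_add_right
        exact Finset.single_le_sum (f := fun i => ∑ j, ∫ τ in s..t, hW n W i j τ)
          (fun i _ => Finset.sum_nonneg fun j _ => hh0 i j) (Finset.mem_univ i)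
    _ ≤ 1 / 2 := by
        rw [← theta_integral hreg]
        linarith [htail s t hs hst.le]

lemma reach_first {α : Type*} {R : α → α → Prop} {i j : α} {k : ℕ} (h : ReachIn R k i j)
    (hij : i ≠ j) : ∃ m, R i m := by
  cases k with
  | zero => exact absurd h hij
  | succ k => exact ⟨h.choose, h.choose_spec.1⟩

lemma reach_trans {α : Type*} {R : α → α → Prop} {j l : α} {b : ℕ} (h2 : ReachIn R b j l)
    (a : ℕ) : ∀ i, ReachIn R a i j → ReachIn R (a + b) i l := by
  induction a with
  | zero =>
    intro i h1
    have : i = j := h1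
    subst this
    simpa using h2
  | succ a ih =>
    rintro i ⟨m, h3, h4⟩
    rw [show a + 1 + b = (a + b) + 1 by ring]
    exact ⟨m, h3, ih m h4⟩

lemma agree_of_qsc {n : ℕ} (hn : 2 ≤ n) {W : ℝ → Fin n → Fin n → ℝ} (hreg : CRegular n W)
    {A : ℝ} (hA : 1 < A) (hA5 : CIntegralArcBalance n W A) (h : CQSC n W) : CAgree n W := by
  obtain ⟨c, hc⟩ := h
  have href : ∃ m, CPersistent n W c m := by
    by_cases h0 : c = ⟨0, by omega⟩
    · obtain ⟨k, hk⟩ := hc ⟨1, by omega⟩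
      exact reach_first hk (by rw [h0]; simp)
    · obtain ⟨k, hk⟩ := hc ⟨0, by omega⟩
      exact reach_first hk h0
  obtain ⟨i0, href⟩ := href
  choose κ hκ using hc
  intro t0 ht0 x hx
  obtain ⟨T0, hT0, htail⟩ := theta_tail hn hreg t0
  have hw := exists_win hn hreg hA hA5 i0 c href (ht0.trans hT0) htail
  choose! f hf using hw
  have hge : ∀ k, T0 ≤ f^[k] T0 := by
    intro k
    induction k with
    | zero => simp
    | succ k ih =>
      rw [Function.iterate_succ_apply']
      exact ih.trans (hf _ ih).1
  have hn2 : (2 : ℝ) ≤ n := by exact_mod_cast hn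
  refine agree_of_wins hn hreg c (∑ v, κ v)
    (fun v => ⟨κ v, Finset.single_le_sum (fun _ _ => Nat.zero_le _) (Finset.mem_univ v), hκ v⟩)
    (p := A⁻¹ * (1 / (4 * n * A))) (by positivity) ?_ (fun k => f^[k] T0) (fun k => ?_)
    (by simpa using hT0) hx
  · have h1 : A⁻¹ ≤ 1 := inv_le_one_of_one_le₀ hA.le
    have h2 : 1 / (4 * n * A) ≤ 1 := by
      rw [div_le_one (by positivity)]
      nlinarith
    exact mul_le_one₀ h1 (by positivity) h2
  · rw [Function.iterate_succ_apply']
    exact hf _ (hge k)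

lemma closed_stay {n : ℕ} {W : ℝ → Fin n → Fin n → ℝ} (hreg : CRegular n W)
    (S : Finset (Fin n)) (hS : ∀ i ∈ S, ∀ j, CPersistent n W j i → j ∈ S) {t0 : ℝ}
    (htail : ∀ s t, t0 ≤ s → s ≤ t → ∫ τ in s..t, cTheta n W τ ≤ 1 / 4)
    {x : ℝ → Fin n → ℝ} (hx : CSol n W t0 x) (h0 : ∀ i, 0 ≤ x t0 i) (h1 : ∀ i, x t0 i ≤ 1)
    (hS1 : ∀ i ∈ S, x t0 i = 1) : ∀ t, t0 ≤ t → ∀ i ∈ S, 3 / 4 ≤ x t i := by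
  intro t ht i hi
  have hx0 := sol_nonneg hreg hx h0
  have hx1 : ∀ t, t0 ≤ t → ∀ i, x t i ≤ 1 := fun t ht i => sol_le_max hreg hx h1 ht i
  have key := pos_inv hreg S t0 (fun t i => x t i - 1 + ∫ τ in t0..t, cTheta n W τ)
    (fun τ i => (∑ j, W τ i j * (x τ j - x τ i)) + cTheta n W τ)
    (fun i _ => ((hx.1 i).sub continuousOn_const).add
      (intervalIntegral.continuous_primitive (fun a b => theta_int hreg a b) t0).continuousOn)
    (fun i _ s t hs hst => by
      refine ⟨(sol_int hreg hx i hs hst).add (theta_int hreg s t), ?_⟩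
      rw [intervalIntegral.integral_add (sol_int hreg hx i hs hst) (theta_int hreg s t),
        sol_eq hreg hx i hs hst,
        ← intervalIntegral.integral_add_adjacent_intervals (theta_int hreg t0 s)
          (theta_int hreg s t)]
      ring)
    (fun i hi τ hτ => by
      have e : ∀ j, W τ i j * ((x τ j - 1 + ∫ τ in t0..τ, cTheta n W τ)
          - (x τ i - 1 + ∫ τ in t0..τ, cTheta n W τ)) = W τ i j * (x τ j - x τ i) := by
        intro j; ring
      simp only [e]
      have hsplit := Finset.sum_add_sum_compl S (fun j => W τ i j * (x τ j - x τ i))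
      have hc : ∑ j ∈ Sᶜ, - (W τ i j * (x τ j - x τ i)) ≤ ∑ j ∈ Sᶜ, hW n W i j τ := by
        apply Finset.sum_le_sum
        intro j hj
        have hjS : j ∉ S := Finset.mem_compl.1 hj
        have hp : j ≠ i ∧ ¬ CPersistent n W j i :=
          ⟨fun h => hjS (h ▸ hi), fun h => hjS (hS i hi j h)⟩
        unfold hW
        rw [if_pos hp]
        nlinarith [hreg.1 τ i j, hx0 τ hτ j, hx1 τ hτ i]
      have hc2 : ∑ j ∈ Sᶜ, hW n W i j τ ≤ ∑ j, hW n W i j τ :=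
        Finset.sum_le_sum_of_subset_of_nonneg (Finset.subset_univ _)
          fun j _ _ => hW_nonneg hreg i j τ
      have hc3 : ∑ j, hW n W i j τ ≤ cTheta n W τ :=
        Finset.single_le_sum (f := fun i => ∑ j, hW n W i j τ)
          (fun i _ => Finset.sum_nonneg fun j _ => hW_nonneg hreg i j τ) (Finset.mem_univ i)
      rw [Finset.sum_neg_distrib] at hc
      linarith)
    (fun i hi => by simp [hS1 i hi]) t ht i hi
  have := htail t0 t le_rfl ht
  linarith

open scoped Classical in
lemma qsc_of_agree {n : ℕ} (hn : 2 ≤ n) {W : ℝ → Fin n → Fin n → ℝ} (hreg : CRegular n W)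
    (hex : CSolExists n W) (h : CAgree n W) : CQSC n W := by
  by_contra hq
  let R : Fin n → Fin n → Prop := fun i j => ∃ k, ReachIn (CPersistent n W) k i j
  have htr : ∀ a b c, R a b → R b c → R a c := by
    rintro a b c ⟨k, hk⟩ ⟨l, hl⟩
    exact ⟨k + l, reach_trans hl k a hk⟩
  have hrf : ∀ a, R a a := fun a => ⟨0, rfl⟩
  have hst : ∀ a b, CPersistent n W a b → R a b := fun a b hab => ⟨1, b, hab, rfl⟩
  obtain ⟨c, -, hc⟩ := Finset.univ.exists_max_image
    (fun c : Fin n => (Finset.univ.filter fun v => R c v).card) ⟨⟨0, by omega⟩, Finset.mem_univ _⟩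
  have hv : ∃ v, ¬ R c v := by
    by_contra! hv
    exact hq ⟨c, hv⟩
  obtain ⟨v, hv⟩ := hv
  have hdisj : ∀ u, R u c → ¬ R u v := by
    intro u huc huv
    have h1 := hc u (Finset.mem_univ u)
    have h2 : (Finset.univ.filter fun v => R c v) ⊂ (Finset.univ.filter fun v => R u v) := by
      rw [Finset.ssubset_iff_of_subset]
      · exact ⟨v, by simpa using huv, by simpa using hv⟩
      · intro w hw
        simp only [Finset.mem_filter, Finset.mem_univ, true_and] at hw ⊢
        exact htr _ _ _ huc hw
    exact absurd (Finset.card_lt_card h2) (not_lt.2 h1)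
  obtain ⟨t0, ht0, htail⟩ := theta_tail hn hreg 0
  obtain ⟨x, hx, hx0⟩ := hex t0 ht0 (fun i => if R i c then 1 else 0)
  have hb0 : ∀ i, 0 ≤ x t0 i := by
    intro i; rw [hx0]; split_ifs <;> norm_num
  have hb1 : ∀ i, x t0 i ≤ 1 := by
    intro i; rw [hx0]; split_ifs <;> norm_num
  have k1 := closed_stay hreg (Finset.univ.filter fun u => R u c)
    (by
      intro i hi j hj
      simp only [Finset.mem_filter, Finset.mem_univ, true_and] at hi ⊢
      exact htr _ _ _ (hst _ _ hj) hi) htail hx hb0 hb1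
    (by
      intro i hi
      simp only [Finset.mem_filter, Finset.mem_univ, true_and] at hi
      rw [hx0, if_pos hi])
  have k2 := closed_stay hreg (Finset.univ.filter fun u => R u v)
    (by
      intro i hi j hj
      simp only [Finset.mem_filter, Finset.mem_univ, true_and] at hi ⊢
      exact htr _ _ _ (hst _ _ hj) hi) htail (sol_affine hx 1 (-1))
    (fun i => by linarith [hb1 i]) (fun i => by linarith [hb0 i])
    (by
      intro i hi
      simp only [Finset.mem_filter, Finset.mem_univ, true_and] at hi
      rw [hx0, if_neg (fun hic => hdisj i hic hi)]
      norm_num)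
  have hlim := h t0 ht0 x hx
  obtain ⟨t, ht1, ht2⟩ := ((hlim.eventually (gt_mem_nhds (show (0 : ℝ) < 1 / 2 by norm_num))).and
    (eventually_ge_atTop t0)).exists
  have e1 := k1 t ht2 c (by simpa using hrf c)
  have e2 := k2 t ht2 v (by simpa using hrf v)
  have e3 := le_cMax x t c
  have e4 := cMin_le x t v
  unfold cH at ht1
  linarith

/-- Under A5 (integral arc balance) and assuming solutions exist, global
agreement holds iff the persistent graph is quasi-strongly connected. -/
theorem continuous_agreement_iff_qsc_integral_balance
    (n : ℕ) (hn : 2 ≤ n) (W : ℝ → Fin n → Fin n → ℝ)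
    (hreg : CRegular n W)
    (A : ℝ) (hA : 1 < A) (hA5 : CIntegralArcBalance n W A)
    (hex : CSolExists n W) :
    CAgree n W ↔ CQSC n W := by
  exact ⟨qsc_of_agree hn hreg hex, agree_of_qsc hn hreg hA hA5⟩
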